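/- arXiv:1702.08749 — 2 statements merged into one kernel-verified Lean document; each statement's English description precedes it below -/
import Mathlib

section
/- Let A be a good antichain of words in F and let β be an equivalence relation on A. Let θ be the smallest fully invariant congruence on F containing the set of pairs {(u, v) ∈ A × A : β u v}. Then for every u ∈ A and every word w ∈ F with θ u w, one has w ∈ A and β u w. Consequently θ ∈ L_A and the restriction of θ to A equals β. -/
/- `F` is the free monoid over a countably infinite alphabet. -/
abbrev F := FreeMonoid ℕ

/-- A congruence on `F` is fully invariant if it is preserved by all monoid
endomorphisms of `F`. -/
def FullyInvariant (θ : Con F) : Prop :=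
  ∀ ξ : F →* F, ∀ u v : F, θ u v → θ (ξ u) (ξ v)

open scoped Classical in
/-- The endomorphism of `F` deleting all letters from `X` and fixing the other letters. -/
noncomputable def deleteHom (X : Set ℕ) : F →* F :=
  FreeMonoid.lift (fun a => if a ∈ X then 1 else FreeMonoid.of a)

/-- The content of a word: the set of letters occurring in it. -/
def letters (w : F) : Set ℕ := {a | a ∈ FreeMonoid.toList w}

/-- The number of occurrences of the letter `x` in the word `w`. -/
def occ (x : ℕ) (w : F) : ℕ := (FreeMonoid.toList w).count x

/-- The commutativity congruence `κ` (as a binary relation): every letter occurs the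
same number of times in `u` as in `v`. -/
def kappaRel (u v : F) : Prop := ∀ x : ℕ, occ x u = occ x v

/-- An endomorphism is nonerasing if it sends every letter to a nonempty word. -/
def Nonerasing (ξ : F →* F) : Prop := ∀ a : ℕ, ξ (FreeMonoid.of a) ≠ 1

/-- `Preceq u v` iff `v = a * ξ u * b` for some words `a, b` and nonerasing `ξ`. -/
def Preceq (u v : F) : Prop :=
  ∃ a b : F, ∃ ξ : F →* F, Nonerasing ξ ∧ v = a * ξ u * b

/-- A set `A` of nonempty words is a good antichain if it is an antichain with respect
to `Preceq`, and any two members have the same content and become equal after deleting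
any nonempty subset of the content. -/
def GoodAntichain (A : Set F) : Prop :=
  (∀ u ∈ A, u ≠ 1) ∧
  (∀ u ∈ A, ∀ v ∈ A, Preceq u v → u = v) ∧
  (∀ u ∈ A, ∀ v ∈ A, letters u = letters v ∧
    ∀ X : Set ℕ, X.Nonempty → X ⊆ letters u → deleteHom X u = deleteHom X v)

/-- Membership in `L_A`: a fully invariant congruence on `F` such that `A` is a union
of its classes. -/
def memLA (A : Set F) (θ : Con F) : Prop :=
  FullyInvariant θ ∧ ∀ u ∈ A, ∀ w : F, θ u w → w ∈ A

/-- The restriction of a congruence `θ` on `F` to the equivalence relation it induces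
on the subset `A`. -/
def restrictA (A : Set F) (θ : Con F) : Setoid ↥A :=
  Setoid.comap Subtype.val θ.toSetoid

/-- The smallest fully invariant congruence on `F` containing `S`. -/
def ficGen (S : Set (F × F)) : Con F :=
  sInf {θ : Con F | FullyInvariant θ ∧ ∀ p ∈ S, θ p.1 p.2}

/-- The set of pairs of members of `A` related by `β`. -/
def betaPairs (A : Set F) (β : Setoid ↥A) : Set (F × F) :=
  {p | ∃ hu : p.1 ∈ A, ∃ hv : p.2 ∈ A, β.r ⟨p.1, hu⟩ ⟨p.2, hv⟩}

theorem map_eq_of_eqOn_letters (ξ η : F →* F) (s : F)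
    (h : ∀ x ∈ letters s, ξ (FreeMonoid.of x) = η (FreeMonoid.of x)) : ξ s = η s := by
  induction s using FreeMonoid.inductionOn' with
  | one => simp
  | of_mul x s ih =>
    rw [map_mul, map_mul, h x (by simp [letters]),
      ih fun y hy => h y (by simpa [letters] using Or.inr hy)]

theorem map_deleteHom (ξ : F →* F) (X : Set ℕ) (h : ∀ x ∈ X, ξ (FreeMonoid.of x) = 1) (s : F) :
    ξ (deleteHom X s) = ξ s := by
  classical
  refine DFunLike.congr_fun (f := ξ.comp (deleteHom X)) (g := ξ) (FreeMonoid.hom_eq fun x => ?_) s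
  by_cases hx : x ∈ X <;> simp [deleteHom, hx, h]

theorem Nonerasing.length_le {η : F →* F} (hη : Nonerasing η) (s : F) :
    s.length ≤ (η s).length := by
  induction s using FreeMonoid.inductionOn' with
  | one => simp
  | of_mul x s ih =>
    have : (η (FreeMonoid.of x)).length ≠ 0 := fun h => hη x (FreeMonoid.length_eq_zero.1 h)
    simp only [map_mul, FreeMonoid.length_mul, FreeMonoid.length_of]
    omega

theorem Nonerasing.map_of_eq_of_map_eq {η : F →* F} (hη : Nonerasing η) (s : F) (h : η s = s) :
    ∀ x ∈ letters s, η (FreeMonoid.of x) = FreeMonoid.of x := by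
  induction s using FreeMonoid.inductionOn' with
  | one => simp [letters]
  | of_mul x s ih =>
    have hx : (η (FreeMonoid.of x)).length ≠ 0 := fun h => hη x (FreeMonoid.length_eq_zero.1 h)
    have hlen := congrArg FreeMonoid.length h
    have hle := hη.length_le s
    rw [map_mul] at h hlen
    simp only [FreeMonoid.length_mul, FreeMonoid.length_of] at hlen
    obtain ⟨h₁, h₂⟩ := List.append_inj (s₁ := FreeMonoid.toList (η (FreeMonoid.of x)))
      (s₂ := FreeMonoid.toList (FreeMonoid.of x)) h
      (show (η (FreeMonoid.of x)).length = 1 by omega)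
    intro y hy
    have hy' : y = x ∨ y ∈ letters s := by simpa [letters] using hy
    rcases hy' with rfl | hy'
    · exact h₁
    · exact ih h₂ y hy'

theorem Nonerasing.eq_one_of_mul_map_mul_eq {η : F →* F} (hη : Nonerasing η) {a b s : F}
    (h : a * η s * b = s) : a = 1 ∧ b = 1 := by
  have hlen := congrArg FreeMonoid.length h
  have hle := hη.length_le s
  simp only [FreeMonoid.length_mul] at hlen
  exact ⟨FreeMonoid.length_eq_zero.1 (by omega), FreeMonoid.length_eq_zero.1 (by omega)⟩

/-- If a word obtained by substituting `s` into a context lies in a good antichain containing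
`s` and `t`, then replacing `s` by `t` either changes nothing or replaces `s` by `t` outright. -/
theorem GoodAntichain.substitution_eq {A : Set F} (hA : GoodAntichain A) {s t : F}
    (hs : s ∈ A) (ht : t ∈ A) (a b : F) (ξ : F →* F) (hu : a * ξ s * b ∈ A) :
    a * ξ t * b = a * ξ s * b ∨ a * ξ s * b = s ∧ a * ξ t * b = t := by
  classical
  obtain ⟨-, hanti, hdel⟩ := hA
  obtain ⟨hcon, hdel⟩ := hdel s hs t ht
  set X : Set ℕ := {x | x ∈ letters s ∧ ξ (FreeMonoid.of x) = 1} with hX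
  by_cases hne : X.Nonempty
  · left
    rw [← map_deleteHom ξ X (fun x hx => hx.2) t, ← hdel X hne fun x hx => hx.1,
      map_deleteHom ξ X fun x hx => hx.2]
  · right
    let η : F →* F := FreeMonoid.lift fun x =>
      if ξ (FreeMonoid.of x) = 1 then FreeMonoid.of x else ξ (FreeMonoid.of x)
    have hη : Nonerasing η := by
      intro x
      by_cases hx : ξ (FreeMonoid.of x) = 1 <;> simp [η, hx]
    have hξη : ∀ x ∈ letters s, ξ (FreeMonoid.of x) = η (FreeMonoid.of x) := by
      intro x hx
      have : ξ (FreeMonoid.of x) ≠ 1 := fun h => hne ⟨x, hx, h⟩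
      simp [η, this]
    rw [map_eq_of_eqOn_letters ξ η s hξη] at hu ⊢
    rw [map_eq_of_eqOn_letters ξ η t (hcon ▸ hξη)]
    have hsu := hanti s hs _ hu ⟨a, b, η, hη, rfl⟩
    obtain ⟨rfl, rfl⟩ := hη.eq_one_of_mul_map_mul_eq hsu.symm
    rw [one_mul, mul_one] at hsu ⊢
    refine ⟨hsu.symm, ?_⟩
    rw [one_mul, mul_one, map_eq_of_eqOn_letters η (MonoidHom.id F) t
      (hcon ▸ hη.map_of_eq_of_map_eq s hsu.symm), MonoidHom.id_apply]

/-- The equivalence relation on words that extends `β` by a single class, the complement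
of `A`. -/
def extendSetoid {A : Set F} (β : Setoid A) : Setoid F where
  r u w := (u ∈ A ↔ w ∈ A) ∧ ∀ (hu : u ∈ A) (hw : w ∈ A), β.r ⟨u, hu⟩ ⟨w, hw⟩
  iseqv :=
    { refl := fun _ => ⟨Iff.rfl, fun _ _ => β.refl _⟩
      symm := fun h => ⟨h.1.symm, fun hu hw => β.symm (h.2 hw hu)⟩
      trans := fun h h' => ⟨h.1.trans h'.1, fun hu hw =>
        β.trans (h.2 hu (h.1.1 hu)) (h'.2 (h.1.1 hu) hw)⟩ }

/-- The largest fully invariant congruence contained in an equivalence relation on `F`. -/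
def invariantCore (r : Setoid F) : Con F where
  r u w := ∀ (a b : F) (ξ : F →* F), r.r (a * ξ u * b) (a * ξ w * b)
  iseqv :=
    { refl := fun _ _ _ _ => r.refl _
      symm := fun h a b ξ => r.symm (h a b ξ)
      trans := fun h h' a b ξ => r.trans (h a b ξ) (h' a b ξ) }
  mul' := by
    intro u u' w w' h h' a b ξ
    have h₁ := h a (ξ w * b) ξ
    have h₂ := h' (a * ξ u') b ξ
    simp only [map_mul, mul_assoc] at h₁ h₂ ⊢
    exact r.trans h₁ h₂

theorem fullyInvariant_invariantCore (r : Setoid F) : FullyInvariant (invariantCore r) :=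
  fun η _ _ h a b ξ => h a b (ξ.comp η)

theorem invariantCore_le {r : Setoid F} {u w : F} (h : invariantCore r u w) : r.r u w := by
  have : r.r (1 * u * 1) (1 * w * 1) := h 1 1 (MonoidHom.id F)
  simpa only [one_mul, mul_one] using this

theorem fullyInvariant_ficGen (S : Set (F × F)) : FullyInvariant (ficGen S) :=
  fun ξ u v h θ hθ => hθ.1 ξ u v (h θ hθ)

theorem GoodAntichain.invariantCore_extendSetoid {A : Set F} (hA : GoodAntichain A)
    {β : Setoid A} {s t : F} (hs : s ∈ A) (ht : t ∈ A) (hst : β.r ⟨s, hs⟩ ⟨t, ht⟩) :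
    invariantCore (extendSetoid β) s t := by
  have key : (extendSetoid β).r s t := ⟨iff_of_true hs ht, fun _ _ => hst⟩
  intro a b ξ
  by_cases hu : a * ξ s * b ∈ A
  · rcases hA.substitution_eq hs ht a b ξ hu with h | ⟨h₁, h₂⟩
    · rw [h]
    · rwa [h₁, h₂]
  · by_cases hw : a * ξ t * b ∈ A
    · rcases hA.substitution_eq ht hs a b ξ hw with h | ⟨h₁, h₂⟩
      · rw [h]
      · rwa [h₁, h₂]
    · exact ⟨iff_of_false hu hw, fun h => absurd h hu⟩

/-- Let `A` be a good antichain, `β` an equivalence relation on `A`, and `θ` the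
smallest fully invariant congruence on `F` containing the pairs of `A`-words related
by `β`. Then whenever `θ u w` with `u ∈ A`, also `w ∈ A` and `β u w`; consequently
`θ ∈ L_A` and the restriction of `θ` to `A` equals `β`. -/
theorem stmt5 (A : Set F) (hA : GoodAntichain A) (β : Setoid ↥A) :
    (∀ u : F, ∀ hu : u ∈ A, ∀ w : F, ficGen (betaPairs A β) u w →
      ∃ hw : w ∈ A, β.r ⟨u, hu⟩ ⟨w, hw⟩) ∧
    memLA A (ficGen (betaPairs A β)) ∧
    restrictA A (ficGen (betaPairs A β)) = β := by
  have main : ∀ u : F, ∀ hu : u ∈ A, ∀ w : F, ficGen (betaPairs A β) u w →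
      ∃ hw : w ∈ A, β.r ⟨u, hu⟩ ⟨w, hw⟩ := by
    intro u hu w h
    have h' : (extendSetoid β).r u w := invariantCore_le <| h _
      ⟨fullyInvariant_invariantCore _, fun _ ⟨hs, ht, hst⟩ =>
        hA.invariantCore_extendSetoid hs ht hst⟩
    exact ⟨h'.1.1 hu, h'.2 hu _⟩
  refine ⟨main, ⟨fullyInvariant_ficGen _, fun u hu w h => (main u hu w h).1⟩, ?_⟩
  refine Setoid.ext fun u w => ⟨fun h => ?_, fun h θ hθ => ?_⟩
  · exact (main u u.2 w h).2
  · exact hθ.2 (u, w) ⟨u.2, w.2, h⟩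
end

section
/- For every finite lattice L there exist a sublattice S of the lattice of congruences on F, all of whose members are overcommutative fully invariant congruences, and a surjective lattice homomorphism from S onto L. -/
/-- Points of a universal set whose partition lattice contains the lattice `L`: every pair of points
`x`, `y` is joined, for all `a b : L`, by a chain `x`, `left`, `mid`, `right`, `y`. -/
inductive ChainPoint (L : Type*) where
  | root : ChainPoint L
  | base (l : L) : ChainPoint L
  | mid (x y : ChainPoint L) (a b : L) : ChainPoint L
  | left (x y : ChainPoint L) (a b : L) : ChainPoint L
  | right (x y : ChainPoint L) (a b : L) : ChainPoint L

namespace ChainPoint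

variable {L : Type*}

/-- The stage at which a point is adjoined. -/
def rank : ChainPoint L → ℕ
  | root => 0
  | base _ => 1
  | mid x y _ _ => rank x + rank y + 2
  | left x y _ _ => rank x + rank y + 3
  | right x y _ _ => rank x + rank y + 3

/-- A numbering of points obtained from a numbering of `L`. -/
def number (g : L → ℕ) : ChainPoint L → ℕ
  | root => Nat.pair 0 0
  | base l => Nat.pair 1 (g l)
  | mid x y a b => Nat.pair 2 (Nat.pair (Nat.pair (number g x) (number g y)) (Nat.pair (g a) (g b)))
  | left x y a b =>
      Nat.pair 3 (Nat.pair (Nat.pair (number g x) (number g y)) (Nat.pair (g a) (g b)))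
  | right x y a b =>
      Nat.pair 4 (Nat.pair (Nat.pair (number g x) (number g y)) (Nat.pair (g a) (g b)))

theorem number_injective {g : L → ℕ} (hg : Function.Injective g) :
    Function.Injective (number g) := by
  intro u
  induction u <;> intro v h <;> cases v <;> simp [number, Nat.pair_eq_pair, hg.eq_iff] at h ⊢ <;>
    grind

instance [Countable L] : Countable (ChainPoint L) := by
  obtain ⟨g, hg⟩ := exists_injective_nat L
  exact (number_injective hg).countable

variable [Lattice L]

open scoped Classical in
/-- The earliest representative of a point modulo the equivalence relation attached to `c`. -/
noncomputable def nf : ChainPoint L → L → ChainPoint L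
  | root, _ => root
  | base l, c => if l ≤ c then root else base l
  | mid x y a b, c =>
      if nf x (a ⊔ b) = nf y (a ⊔ b) ∧ a ≤ c ∧ b ≤ c then nf x c else mid x y a b
  | left x y a b, c =>
      if nf x (a ⊔ b) = nf y (a ⊔ b) then
        if a ≤ c then nf x c else if b ≤ c then mid x y a b else left x y a b
      else left x y a b
  | right x y a b, c =>
      if nf x (a ⊔ b) = nf y (a ⊔ b) then
        if b ≤ c then nf y c else if a ≤ c then mid x y a b else right x y a b
      else right x y a b

theorem nf_nf {c d : L} (h : c ≤ d) (u : ChainPoint L) : nf (nf u c) d = nf u d := by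
  induction u generalizing c d with
  | root => rfl
  | base l => grind [nf]
  | mid x y a b ihx ihy => grind [nf]
  | left x y a b ihx ihy => grind [nf]
  | right x y a b ihx ihy =>
    have key : nf x (a ⊔ b) = nf y (a ⊔ b) → a ≤ d → b ≤ d → nf x d = nf y d := by
      intro h ha hb
      rw [← ihx (sup_le ha hb), h, ihy (sup_le ha hb)]
    grind [nf]

theorem nf_eq_of_le {c d : L} (h : c ≤ d) {u v : ChainPoint L} (huv : nf u c = nf v c) :
    nf u d = nf v d := by
  rw [← nf_nf h, huv, nf_nf h]

theorem rank_nf_le (u : ChainPoint L) (c : L) : rank (nf u c) ≤ rank u := by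
  induction u generalizing c <;> grind [nf, rank]

theorem nf_eq_self_or_rank_lt (u : ChainPoint L) (c : L) :
    nf u c = u ∨ rank (nf u c) < rank u := by
  cases u <;> grind [nf, rank, rank_nf_le]

theorem eq_of_normal_of_rank_le {c d : L} {u v : ChainPoint L} (hu : nf u (c ⊓ d) = u)
    (hv : nf v (c ⊓ d) = v) (hc : nf u c = nf v c) (hd : nf u d = nf v d)
    (huv : rank v ≤ rank u) : u = v := by
  have h₁ := nf_eq_self_or_rank_lt u c
  have h₂ := nf_eq_self_or_rank_lt v c
  have h₃ := nf_eq_self_or_rank_lt u d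
  have h₄ := nf_eq_self_or_rank_lt v d
  have hle : ∀ l : L, l ≤ c ⊓ d ↔ l ≤ c ∧ l ≤ d := fun l => le_inf_iff
  by_contra hne
  cases u with
  | root => grind [nf, rank]
  | base l => grind [nf, rank]
  | mid x y a b => grind [nf, rank, rank_nf_le]
  | left x y a b =>
    cases v <;> grind [nf, rank, rank_nf_le]
  | right x y a b =>
    cases v <;> grind [nf, rank, rank_nf_le]

theorem nf_inf {c d : L} {u v : ChainPoint L} (hc : nf u c = nf v c) (hd : nf u d = nf v d) :
    nf u (c ⊓ d) = nf v (c ⊓ d) := by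
  have hc' : nf (nf u (c ⊓ d)) c = nf (nf v (c ⊓ d)) c := by
    rwa [nf_nf inf_le_left, nf_nf inf_le_left]
  have hd' : nf (nf u (c ⊓ d)) d = nf (nf v (c ⊓ d)) d := by
    rwa [nf_nf inf_le_right, nf_nf inf_le_right]
  rcases le_total (rank (nf v (c ⊓ d))) (rank (nf u (c ⊓ d))) with h | h
  · exact eq_of_normal_of_rank_le (nf_nf le_rfl u) (nf_nf le_rfl v) hc' hd' h
  · exact (eq_of_normal_of_rank_le (nf_nf le_rfl v) (nf_nf le_rfl u) hc'.symm hd'.symm h).symm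

/-- The equivalence relation on `ChainPoint L` attached to `c : L`. -/
noncomputable def equivAt (c : L) : Setoid (ChainPoint L) := Setoid.ker (nf · c)

theorem equivAt_le_iff {c d : L} : equivAt c ≤ equivAt d ↔ c ≤ d := by
  refine ⟨fun h => ?_, fun h u v huv => nf_eq_of_le h huv⟩
  have : nf (base c) d = nf root d := h (x := base c) (y := root) (by
    change nf _ _ = nf _ _
    simp [nf])
  by_contra hcd
  simp [nf, hcd] at this

theorem equivAt_inf_le (c d : L) : equivAt c ⊓ equivAt d ≤ equivAt (c ⊓ d) :=
  fun _ _ h => nf_inf h.1 h.2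

theorem equivAt_sup_le (a b : L) : equivAt (a ⊔ b) ≤ equivAt a ⊔ equivAt b := by
  intro x y hxy
  replace hxy : nf x (a ⊔ b) = nf y (a ⊔ b) := hxy
  have ha : ∀ {u v : ChainPoint L}, nf u a = nf v a → (equivAt a ⊔ equivAt b) u v := fun h =>
    (le_sup_left : equivAt a ≤ equivAt a ⊔ equivAt b) h
  have hb : ∀ {u v : ChainPoint L}, nf u b = nf v b → (equivAt a ⊔ equivAt b) u v := fun h =>
    (le_sup_right : equivAt b ≤ equivAt a ⊔ equivAt b) h
  have h₁ : nf x a = nf (left x y a b) a := by simp [nf, hxy]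
  have h₂ : nf (left x y a b) b = nf (mid x y a b) b := by grind [nf]
  have h₃ : nf (mid x y a b) a = nf (right x y a b) a := by
    have : b ≤ a → nf x a = nf y a := fun h => nf_eq_of_le (sup_le le_rfl h) hxy
    grind [nf]
  have h₄ : nf (right x y a b) b = nf y b := by simp [nf, hxy]
  exact Setoid.trans' _ (ha h₁) (Setoid.trans' _ (hb h₂) (Setoid.trans' _ (ha h₃) (hb h₄)))

end ChainPoint

theorem occ_one (c : ℕ) : occ c 1 = 0 := rfl

theorem occ_mul (c : ℕ) (u v : F) : occ c (u * v) = occ c u + occ c v :=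
  List.count_append

theorem occ_of (c a : ℕ) : occ c (FreeMonoid.of a) = if a = c then 1 else 0 := by
  simp [occ, List.count_singleton]

theorem occ_pow (c : ℕ) (u : F) (n : ℕ) : occ c (u ^ n) = n * occ c u := by
  induction n with
  | zero => simp [occ_one]
  | succ n ih => rw [pow_succ, occ_mul, ih, Nat.succ_mul]

theorem exists_eq_pow_of_occ_eq_zero {a : ℕ} {u : F} (h : ∀ c, c ≠ a → occ c u = 0) :
    ∃ k, u = FreeMonoid.of a ^ k := by
  induction u using FreeMonoid.inductionOn' with
  | one => exact ⟨0, rfl⟩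
  | of_mul b u ih =>
    have hb : b = a := by
      by_contra hba
      have := h b hba
      simp [occ_mul, occ_of] at this
    obtain ⟨k, rfl⟩ := ih fun c hc => by
      have := h c hc
      rw [occ_mul] at this
      omega
    exact ⟨k + 1, by rw [hb, pow_succ']⟩

theorem exists_eq_mul_of_occ_pos {a : ℕ} {u : F} (h : 0 < occ a u) :
    ∃ s t : F, u = s * (FreeMonoid.of a * t) :=
  List.append_of_mem (List.count_pos_iff.1 h)

theorem pow_mul_of_mul_inj {a b : ℕ} (hab : a ≠ b) {m n : ℕ} {s t : F}
    (h : FreeMonoid.of a ^ m * (FreeMonoid.of b * s) =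
      FreeMonoid.of a ^ n * (FreeMonoid.of b * t)) : m = n ∧ s = t := by
  induction m generalizing n with
  | zero =>
    cases n with
    | zero => exact ⟨rfl, mul_left_cancel (mul_left_cancel h)⟩
    | succ n =>
      rw [pow_zero, one_mul, pow_succ', mul_assoc] at h
      exact absurd (List.cons.inj h).1.symm hab
  | succ m ih =>
    cases n with
    | zero =>
      rw [pow_zero, one_mul, pow_succ', mul_assoc] at h
      exact absurd (List.cons.inj h).1 hab
    | succ n =>
      rw [pow_succ', pow_succ', mul_assoc, mul_assoc] at h
      have := ih (mul_left_cancel h)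
      exact ⟨congrArg (· + 1) this.1, this.2⟩

/-- The word `y x⁵ y xⁱ y xʲ y` in two letters `x` and `y`. -/
def blockWord (i j : ℕ) : F :=
  FreeMonoid.of 1 * FreeMonoid.of 0 ^ 5 * FreeMonoid.of 1 * FreeMonoid.of 0 ^ i *
    FreeMonoid.of 1 * FreeMonoid.of 0 ^ j * FreeMonoid.of 1

theorem occ_map_blockWord (c : ℕ) (ξ : F →* F) (i j : ℕ) :
    occ c (ξ (blockWord i j)) =
      4 * occ c (ξ (FreeMonoid.of 1)) + (5 + (i + j)) * occ c (ξ (FreeMonoid.of 0)) := by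
  simp only [blockWord, map_mul, map_pow, occ_mul, occ_pow]
  ring

theorem blockWord_inj {i j i' j' : ℕ} (h : blockWord i j = blockWord i' j') :
    i = i' ∧ j = j' := by
  simp only [blockWord, mul_assoc] at h
  obtain ⟨h₁, h⟩ := pow_mul_of_mul_inj zero_ne_one
    (mul_left_cancel (mul_left_cancel (mul_left_cancel h)))
  exact ⟨h₁, (pow_mul_of_mul_inj zero_ne_one (s := 1) (t := 1) (by simpa using h)).1⟩

theorem map_blockWord_of_eq_blockWord {s t : F} {ξ : F →* F} {i j i' j' : ℕ}
    (h : s * ξ (blockWord i j) * t = blockWord i' j') :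
    (∀ k l, k + l = i + j → ξ (blockWord k l) = ξ (blockWord i j)) ∨
      s = 1 ∧ t = 1 ∧ ∀ k l, ξ (blockWord k l) = blockWord k l := by
  have hocc : ∀ c, occ c s + (4 * occ c (ξ (FreeMonoid.of 1)) +
      (5 + (i + j)) * occ c (ξ (FreeMonoid.of 0))) + occ c t =
      4 * (if 1 = c then 1 else 0) + (5 + (i' + j')) * if 0 = c then 1 else 0 := fun c => by
    rw [← occ_map_blockWord, ← occ_mul, ← occ_mul, h, ← occ_of, ← occ_of]
    exact occ_map_blockWord c (MonoidHom.id F) i' j'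
  have hlarge : ∀ c, 2 ≤ c → occ c s = 0 ∧ occ c (ξ (FreeMonoid.of 1)) = 0 ∧
      occ c (ξ (FreeMonoid.of 0)) = 0 ∧ occ c t = 0 := fun c hc => by
    have := hocc c
    rw [if_neg (by omega), if_neg (by omega)] at this
    have h0 : (5 + (i + j)) * occ c (ξ (FreeMonoid.of 0)) = 0 := by omega
    rcases mul_eq_zero.1 h0 with h0 | h0 <;> omega
  have hone := hocc 1
  rw [if_pos rfl, if_neg (by omega)] at hone
  have hx1 : occ 1 (ξ (FreeMonoid.of 0)) = 0 := by
    by_contra hne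
    have := Nat.mul_le_mul_left (5 + (i + j)) (Nat.one_le_iff_ne_zero.2 hne)
    omega
  have hpow : ∀ {u : F}, (∀ c, 2 ≤ c → occ c u = 0) → occ 1 u = 0 →
      ∃ k, u = FreeMonoid.of 0 ^ k := fun hu hu1 =>
    exists_eq_pow_of_occ_eq_zero fun c hc => by
      rcases Nat.lt_or_ge c 2 with hc2 | hc2
      · obtain rfl : c = 1 := by omega
        exact hu1
      · exact hu c hc2
  obtain ⟨c, hX⟩ := hpow (fun c hc => (hlarge c hc).2.2.1) hx1
  rw [hx1] at hone
  rcases Nat.eq_zero_or_pos (occ 1 (ξ (FreeMonoid.of 1))) with hy1 | hy1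
  · left
    obtain ⟨d, hY⟩ := hpow (fun c hc => (hlarge c hc).2.1) hy1
    intro k l hkl
    simp only [blockWord, map_mul, map_pow, hX, hY, ← pow_mul, ← pow_add]
    congr 1
    linear_combination c * hkl
  · right
    obtain ⟨y₁, y₂, hY⟩ := exists_eq_mul_of_occ_pos hy1
    simp only [hY, occ_mul, occ_of, if_true] at hlarge hone
    obtain ⟨m, rfl⟩ := hpow (u := y₁) (fun c hc => by have := hlarge c hc; omega) (by omega)
    obtain ⟨n, rfl⟩ := hpow (u := y₂) (fun c hc => by have := hlarge c hc; omega) (by omega)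
    obtain ⟨p, rfl⟩ := hpow (u := s) (fun c hc => by have := hlarge c hc; omega) (by omega)
    obtain ⟨q, rfl⟩ := hpow (u := t) (fun c hc => by have := hlarge c hc; omega) (by omega)
    have key : FreeMonoid.of 0 ^ (p + m) * (FreeMonoid.of 1 * (FreeMonoid.of 0 ^ (n + c * 5 + m) *
        (FreeMonoid.of 1 * (FreeMonoid.of 0 ^ (n + c * i + m) * (FreeMonoid.of 1 *
          (FreeMonoid.of 0 ^ (n + c * j + m) * (FreeMonoid.of 1 *
            FreeMonoid.of 0 ^ (n + q)))))))) =
        FreeMonoid.of 0 ^ 0 * (FreeMonoid.of 1 * (FreeMonoid.of 0 ^ 5 *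
        (FreeMonoid.of 1 * (FreeMonoid.of 0 ^ i' * (FreeMonoid.of 1 *
          (FreeMonoid.of 0 ^ j' * (FreeMonoid.of 1 * 1))))))) := by
      simpa only [blockWord, map_mul, map_pow, hX, hY, pow_add, pow_mul, mul_assoc, pow_zero,
        one_mul, mul_one] using h
    obtain ⟨h₁, key⟩ := pow_mul_of_mul_inj zero_ne_one key
    obtain ⟨h₂, key⟩ := pow_mul_of_mul_inj zero_ne_one key
    obtain ⟨-, key⟩ := pow_mul_of_mul_inj zero_ne_one key
    obtain ⟨-, key⟩ := pow_mul_of_mul_inj zero_ne_one key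
    have h₃ : n + q = 0 := by simpa [occ_pow, occ_of, occ_one] using congrArg (occ 0) key
    obtain ⟨rfl, rfl, rfl, rfl, rfl⟩ : p = 0 ∧ m = 0 ∧ n = 0 ∧ q = 0 ∧ c = 1 := by omega
    refine ⟨rfl, rfl, fun k l => ?_⟩
    simp only [blockWord, map_mul, map_pow, hX, hY, pow_zero, one_mul, mul_one, pow_one]

theorem FullyInvariant.inf {θ η : Con F} (hθ : FullyInvariant θ) (hη : FullyInvariant η) :
    FullyInvariant (θ ⊓ η) :=
  fun ξ u v h => ⟨hθ ξ u v h.1, hη ξ u v h.2⟩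

theorem FullyInvariant.sup {θ η : Con F} (hθ : FullyInvariant θ) (hη : FullyInvariant η) :
    FullyInvariant (θ ⊔ η) := by
  intro ξ
  have h : θ ⊔ η ≤ (θ ⊔ η).comap ξ (map_mul ξ) := sup_le
    (Con.le_def.2 fun {u v} h => Con.le_def.1 le_sup_left (hθ ξ u v h))
    (Con.le_def.2 fun {u v} h => Con.le_def.1 le_sup_right (hη ξ u v h))
  exact fun u v huv => Con.le_def.1 h huv

/-- The largest fully invariant congruence contained in an equivalence relation on `F`. -/
def fullyInvariantCore (E : Setoid F) : Con F where
  r u v := ∀ (s t : F) (ξ : F →* F), E (s * ξ u * t) (s * ξ v * t)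
  iseqv :=
    { refl := fun _ _ _ _ => E.refl' _
      symm := fun h s t ξ => E.symm' (h s t ξ)
      trans := fun h₁ h₂ s t ξ => E.trans' (h₁ s t ξ) (h₂ s t ξ) }
  mul' {u u' v v'} hu hv s t ξ := by
    have h₁ := hu s (ξ v * t) ξ
    have h₂ := hv (s * ξ u') t ξ
    simp only [map_mul, mul_assoc] at h₁ h₂ ⊢
    exact E.trans' h₁ h₂

theorem fullyInvariant_fullyInvariantCore (E : Setoid F) :
    FullyInvariant (fullyInvariantCore E) :=
  fun ξ _ _ h s t ζ => h s t (ζ.comp ξ)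

theorem fullyInvariantCore_le {E : Setoid F} {u v : F} (h : fullyInvariantCore E u v) : E u v := by
  simpa using h 1 1 (MonoidHom.id F)

theorem fullyInvariantCore_mono {E E' : Setoid F} (h : E ≤ E') :
    fullyInvariantCore E ≤ fullyInvariantCore E' :=
  Con.le_def.2 fun huv s t ξ => h (huv s t ξ)

section Coding

variable {X : Type*}

open scoped Classical in
/-- The point coded by a word. -/
noncomputable def decode (ι : X → ℕ) (w : F) : Option X :=
  if h : ∃ p j, w = blockWord (ι p) j then some h.choose else none

theorem decode_eq_some {ι : X → ℕ} {w : F} {p : X} (h : decode ι w = some p) :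
    ∃ j, w = blockWord (ι p) j := by
  unfold decode at h
  split_ifs at h with hw
  rw [← Option.some.inj h]
  exact hw.choose_spec

theorem decode_blockWord {ι : X → ℕ} (hι : Function.Injective ι) (p : X) (j : ℕ) :
    decode ι (blockWord (ι p) j) = some p := by
  have hw : ∃ q k, blockWord (ι p) j = blockWord (ι q) k := ⟨p, j, rfl⟩
  rw [decode, dif_pos hw]
  obtain ⟨k, hk⟩ := hw.choose_spec
  exact congrArg some (hι (blockWord_inj hk).1).symm

/-- The equivalence relation on `F` induced, below commutativity, by an equivalence relation
on the coded points. -/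
noncomputable def codeSetoid (ι : X → ℕ) (r : Setoid X) : Setoid F :=
  Setoid.ker fun w => (fun c => occ c w, (decode ι w).map (Quotient.mk r))

theorem codeSetoid_iff {ι : X → ℕ} {r : Setoid X} {u v : F} :
    codeSetoid ι r u v ↔
      kappaRel u v ∧ (decode ι u).map (Quotient.mk r) = (decode ι v).map (Quotient.mk r) :=
  Prod.ext_iff.trans (and_congr funext_iff Iff.rfl)

theorem option_map_mk_eq_iff {r : Setoid X} {x y : Option X} :
    x.map (Quotient.mk r) = y.map (Quotient.mk r) ↔ Option.Rel r x y := by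
  cases x <;> cases y <;> simp [Quotient.eq]

theorem codeSetoid_mono (ι : X → ℕ) {r r' : Setoid X} (h : r ≤ r') :
    codeSetoid ι r ≤ codeSetoid ι r' := by
  intro u v huv
  rw [codeSetoid_iff, option_map_mk_eq_iff] at huv ⊢
  obtain ⟨hκ, huv⟩ := huv
  refine ⟨hκ, ?_⟩
  generalize decode ι u = x, decode ι v = y at huv
  cases huv with
  | some hxy => exact .some (h hxy)
  | none => exact .none

theorem codeSetoid_inf_le (ι : X → ℕ) (r r' : Setoid X) :
    codeSetoid ι r ⊓ codeSetoid ι r' ≤ codeSetoid ι (r ⊓ r') := by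
  rintro u v ⟨h, h'⟩
  rw [codeSetoid_iff, option_map_mk_eq_iff] at h h' ⊢
  refine ⟨h.1, ?_⟩
  obtain ⟨-, h⟩ := h
  obtain ⟨-, h'⟩ := h'
  generalize decode ι u = x, decode ι v = y at h h'
  cases h with
  | some hxy =>
    cases h' with
    | some hxy' => exact .some ⟨hxy, hxy'⟩
  | none => exact .none

theorem codeSetoid_blockWord {ι : X → ℕ} (hι : Function.Injective ι) {r : Setoid X} {p q : X}
    {i j : ℕ} (h : codeSetoid ι r (blockWord (ι p) i) (blockWord (ι q) j)) : r p q := by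
  simpa [decode_blockWord hι, Quotient.eq] using (codeSetoid_iff.1 h).2

open Filter

/-- The equivalence relation on coded points induced by a congruence on `F`: the code words of `p`
and `q` are eventually congruent. -/
def eventualSetoid (ι : X → ℕ) (θ : Con F) : Setoid X where
  r p q := ∀ᶠ n in atTop, θ (blockWord (ι p) (n - ι p)) (blockWord (ι q) (n - ι q))
  iseqv :=
    { refl := fun _ => .of_forall fun _ => θ.refl _
      symm := fun h => h.mono fun _ => θ.symm
      trans := fun h₁ h₂ => (h₁.and h₂).mono fun _ h => θ.trans h.1 h.2 }

theorem eventualSetoid_mono (ι : X → ℕ) {θ η : Con F} (h : θ ≤ η) :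
    eventualSetoid ι θ ≤ eventualSetoid ι η :=
  fun _ _ hpq => Eventually.mono hpq fun _ => Con.le_def.1 h

theorem inf_eventualSetoid_le (ι : X → ℕ) (θ η : Con F) :
    eventualSetoid ι θ ⊓ eventualSetoid ι η ≤ eventualSetoid ι (θ ⊓ η) :=
  fun _ _ h => (Eventually.and h.1 h.2).mono fun _ h => h

theorem eventualSetoid_le {ι : X → ℕ} (hι : Function.Injective ι) {r : Setoid X} {θ : Con F}
    (h : θ ≤ fullyInvariantCore (codeSetoid ι r)) : eventualSetoid ι θ ≤ r := by
  intro p q hpq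
  obtain ⟨n, hn⟩ := Eventually.exists hpq
  exact codeSetoid_blockWord hι (fullyInvariantCore_le (Con.le_def.1 h hn))

theorem le_eventualSetoid_fullyInvariantCore {ι : X → ℕ} (hι : Function.Injective ι)
    (r : Setoid X) : r ≤ eventualSetoid ι (fullyInvariantCore (codeSetoid ι r)) := by
  intro p q hpq
  filter_upwards [eventually_ge_atTop (ι p), eventually_ge_atTop (ι q)] with n hp hq s t ξ
  rw [codeSetoid_iff]
  have hsum : ι p + (n - ι p) = ι q + (n - ι q) := by omega
  refine ⟨fun c => ?_, ?_⟩
  · simp only [occ_mul, occ_map_blockWord, hsum]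
  · have hid : (s = 1 ∧ t = 1 ∧ ∀ k l, ξ (blockWord k l) = blockWord k l) →
        (decode ι (s * ξ (blockWord (ι p) (n - ι p)) * t)).map (Quotient.mk r) =
          (decode ι (s * ξ (blockWord (ι q) (n - ι q)) * t)).map (Quotient.mk r) := by
      rintro ⟨rfl, rfl, h⟩
      simpa [h, decode_blockWord hι, Quotient.eq] using hpq
    rcases hu : decode ι (s * ξ (blockWord (ι p) (n - ι p)) * t) with - | a
    · rcases hv : decode ι (s * ξ (blockWord (ι q) (n - ι q)) * t) with - | b
      · rfl
      · obtain ⟨j, hj⟩ := decode_eq_some hv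
        rw [← hu, ← hv]
        rcases map_blockWord_of_eq_blockWord hj with h | h
        · rw [h _ _ hsum]
        · exact hid h
    · obtain ⟨j, hj⟩ := decode_eq_some hu
      rw [← hu]
      rcases map_blockWord_of_eq_blockWord hj with h | h
      · rw [h _ _ hsum.symm]
      · exact hid h

end Coding

section Representation

variable {L : Type*} [Lattice L]

/-- A fully invariant congruence represents `a : L` if on the code words it lies below the
equivalence relation attached to `a` and eventually agrees with it. -/
def Represents (ι : ChainPoint L → ℕ) (θ : Con F) (a : L) : Prop :=
  FullyInvariant θ ∧ θ ≤ fullyInvariantCore (codeSetoid ι (ChainPoint.equivAt a)) ∧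
    ChainPoint.equivAt a ≤ eventualSetoid ι θ

variable {ι : ChainPoint L → ℕ} {θ η : Con F} {a b : L}

theorem Represents.unique (hι : Function.Injective ι) (ha : Represents ι θ a)
    (hb : Represents ι θ b) : a = b :=
  le_antisymm
    (ChainPoint.equivAt_le_iff.1 (ha.2.2.trans (eventualSetoid_le hι hb.2.1)))
    (ChainPoint.equivAt_le_iff.1 (hb.2.2.trans (eventualSetoid_le hι ha.2.1)))

theorem Represents.sup (ha : Represents ι θ a) (hb : Represents ι η b) :
    Represents ι (θ ⊔ η) (a ⊔ b) := by
  refine ⟨ha.1.sup hb.1, sup_le (ha.2.1.trans ?_) (hb.2.1.trans ?_), ?_⟩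
  · exact fullyInvariantCore_mono
      (codeSetoid_mono ι (ChainPoint.equivAt_le_iff.2 le_sup_left))
  · exact fullyInvariantCore_mono
      (codeSetoid_mono ι (ChainPoint.equivAt_le_iff.2 le_sup_right))
  · exact (ChainPoint.equivAt_sup_le a b).trans <| sup_le
      (ha.2.2.trans (eventualSetoid_mono ι le_sup_left))
      (hb.2.2.trans (eventualSetoid_mono ι le_sup_right))

theorem Represents.inf (ha : Represents ι θ a) (hb : Represents ι η b) :
    Represents ι (θ ⊓ η) (a ⊓ b) := by
  refine ⟨ha.1.inf hb.1, ?_, ?_⟩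
  · exact Con.le_def.2 fun huv s t ξ => codeSetoid_mono ι (ChainPoint.equivAt_inf_le a b)
      (codeSetoid_inf_le ι _ _
        ⟨Con.le_def.1 ha.2.1 huv.1 s t ξ, Con.le_def.1 hb.2.1 huv.2 s t ξ⟩)
  · exact (le_inf ((ChainPoint.equivAt_le_iff.2 inf_le_left).trans ha.2.2)
      ((ChainPoint.equivAt_le_iff.2 inf_le_right).trans hb.2.2)).trans
      (inf_eventualSetoid_le ι θ η)

theorem represents_fullyInvariantCore (hι : Function.Injective ι) (a : L) :
    Represents ι (fullyInvariantCore (codeSetoid ι (ChainPoint.equivAt a))) a :=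
  ⟨fullyInvariant_fullyInvariantCore _, le_rfl, le_eventualSetoid_fullyInvariantCore hι _⟩

end Representation

/-- For every finite lattice `L` there are a sublattice `S` of the lattice of
congruences on `F`, all of whose members are overcommutative fully invariant
congruences, and a surjective lattice homomorphism from `S` onto `L`. -/
theorem stmt11 (L : Type*) [Lattice L] [Finite L] :
    ∃ S : Sublattice (Con F),
      (∀ θ ∈ S, FullyInvariant θ ∧ ∀ u v : F, θ u v → kappaRel u v) ∧
      ∃ f : LatticeHom ↥S L, Function.Surjective f := by
  obtain ⟨ι, hι⟩ := exists_injective_nat (ChainPoint L)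
  refine ⟨⟨{θ | ∃ a : L, Represents ι θ a}, ?_, ?_⟩, ?_, ?_⟩
  · rintro θ ⟨a, ha⟩ η ⟨b, hb⟩
    exact ⟨a ⊔ b, ha.sup hb⟩
  · rintro θ ⟨a, ha⟩ η ⟨b, hb⟩
    exact ⟨a ⊓ b, ha.inf hb⟩
  · rintro θ ⟨a, ha⟩
    exact ⟨ha.1, fun u v huv =>
      (codeSetoid_iff.1 (fullyInvariantCore_le (Con.le_def.1 ha.2.1 huv))).1⟩
  · refine ⟨{ toFun := fun θ => θ.2.choose
              map_sup' := fun θ η => ?_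
              map_inf' := fun θ η => ?_ }, fun a => ?_⟩
    · exact (θ ⊔ η).2.choose_spec.unique hι (θ.2.choose_spec.sup η.2.choose_spec)
    · exact (θ ⊓ η).2.choose_spec.unique hι (θ.2.choose_spec.inf η.2.choose_spec)
    · have ha := represents_fullyInvariantCore hι a
      exact ⟨⟨_, a, ha⟩, Exists.choose_spec (⟨a, ha⟩ : ∃ b, Represents ι _ b) |>.unique hι ha⟩
end
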